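/- There is no internally 4-connected binary matroid on exactly 8 elements. -/

import Mathlib

open Set Matroid
open scoped Classical

/-- `M` is the binary matroid on ground set `E` represented by the vectors `v`. -/
def IsBinRepOn {α W : Type*} [AddCommGroup W] [Module (ZMod 2) W]
    (M : Matroid α) (E : Set α) (v : α → W) : Prop :=
  M.E = E ∧ ∀ I ⊆ E, (M.Indep I ↔ LinearIndependent (ZMod 2) (fun x : I => v x))

/-- Isomorphism of matroids: a bijection of ground sets preserving independence. -/
def MatroidIso {α β : Type*} (M : Matroid α) (N : Matroid β) : Prop :=
  ∃ e : M.E ≃ N.E, ∀ I : Set M.E,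
    (M.Indep (Subtype.val '' I) ↔ N.Indep (Subtype.val '' (e '' I)))

/-- The incidence vector of an edge, over GF(2). -/
noncomputable def incVec {V : Type*} (e : Sym2 V) : V → ZMod 2 :=
  fun v => if v ∈ e then 1 else 0

/-- `M` is the cycle matroid of the graph `G`, i.e. the binary matroid on the edge set of `G`
represented by the GF(2) incidence vectors of the edges. -/
def IsCycleMatroidOf {V : Type*} (M : Matroid (Sym2 V)) (G : SimpleGraph V) : Prop :=
  IsBinRepOn M G.edgeSet incVec

/-- Deletion of a set of elements from a matroid. -/
def mDel {α : Type*} (M : Matroid α) (D : Set α) : Matroid α := M ↾ (M.E \ D)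

/-- Contraction of a set of elements in a matroid. -/
def mCon {α : Type*} (M : Matroid α) (C : Set α) : Matroid α := (mDel M✶ C)✶

/-- A circuit of a matroid: a minimal dependent set. -/
def mCircuit {α : Type*} (M : Matroid α) (C : Set α) : Prop :=
  C ⊆ M.E ∧ ¬ M.Indep C ∧ ∀ x ∈ C, M.Indep (C \ {x})

/-- A cocircuit of a matroid: a circuit of the dual. -/
def mCocircuit {α : Type*} (M : Matroid α) (C : Set α) : Prop := mCircuit M✶ C

/-- The rank of a set in a matroid: the supremum of cardinalities of independent subsets. -/
noncomputable def mRk {α : Type*} (M : Matroid α) (X : Set α) : ℕ :=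
  sSup (Set.ncard '' {I | I ⊆ X ∧ M.Indep I})

/-- A `k`-separation of a matroid. -/
def mKSep {α : Type*} (M : Matroid α) (k : ℕ) (X Y : Set α) : Prop :=
  Disjoint X Y ∧ X ∪ Y = M.E ∧ k ≤ X.ncard ∧ k ≤ Y.ncard ∧
    mRk M X + mRk M Y + 1 ≤ mRk M M.E + k

/-- A matroid is `3`-connected if it has no 1- or 2-separations. -/
def mThreeConnected {α : Type*} (M : Matroid α) : Prop :=
  (∀ X Y, ¬ mKSep M 1 X Y) ∧ (∀ X Y, ¬ mKSep M 2 X Y)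

/-- A matroid is internally 4-connected if it is 3-connected and
every 3-separation has a side of size exactly 3. -/
def mInternally4 {α : Type*} (M : Matroid α) : Prop :=
  mThreeConnected M ∧ ∀ X Y, mKSep M 3 X Y → min X.ncard Y.ncard = 3

/-- A matroid is binary if it is representable over GF(2). -/
def mBinary {α : Type*} (M : Matroid α) : Prop :=
  ∃ (n : ℕ) (v : α → (Fin n → ZMod 2)), IsBinRepOn M M.E v

/-- `M` is the uniform matroid of rank `r` on all of `α`. -/
def mUniformOf {α : Type*} (M : Matroid α) (r : ℕ) : Prop :=
  M.E = univ ∧ ∀ I : Set α, (M.Indep I ↔ I.ncard ≤ r)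

/-- The points of the binary projective space of rank 4, `PG(3,2)`. -/
abbrev PGpt (n : ℕ) := {v : Fin n → ZMod 2 // v ≠ 0}

/-- The quartic Möbius ladder on `2n+1` vertices. -/
def qml (n : ℕ) : SimpleGraph (ZMod (2 * n + 1)) :=
  SimpleGraph.circulantGraph {1, (n : ZMod (2 * n + 1))}

/-- The cubic Möbius ladder on `2n` vertices. -/
def cml (n : ℕ) : SimpleGraph (ZMod (2 * n)) :=
  SimpleGraph.circulantGraph {1, (n : ZMod (2 * n))}
def par4 (n : ℕ) : ℕ := (27030 >>> n) % 2
def pop4 (n : ℕ) : ℕ := n % 2 + n / 2 % 2 + n / 4 % 2 + n / 8 % 2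
def wt4 (a b c d f : ℕ) : ℕ :=
  pop4 f + par4 (f &&& a) + par4 (f &&& b) + par4 (f &&& c) + par4 (f &&& d)
def dis4 (a b c d f g : ℕ) : Bool :=
  Nat.beq (f &&& g) 0 && (Nat.beq (par4 (f &&& a) * par4 (g &&& a)) 0 &&
    (Nat.beq (par4 (f &&& b) * par4 (g &&& b)) 0 &&
    (Nat.beq (par4 (f &&& c) * par4 (g &&& c)) 0 && Nat.beq (par4 (f &&& d) * par4 (g &&& d)) 0)))
def l15 : List ℕ := [1,2,3,4,5,6,7,8,9,10,11,12,13,14,15]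
def l11 : List ℕ := [3,5,6,7,9,10,11,12,13,14,15]
def good4 (a b c d : ℕ) : Bool :=
  l15.any fun f => Nat.ble (wt4 a b c d f) 2 || (Nat.ble (wt4 a b c d f) 4 &&
    l15.any fun g => dis4 a b c d f g && Nat.ble (wt4 a b c d g) 4)
def all4 : Bool :=
  l11.all fun a => l11.all fun b => Nat.ble b a || (l11.all fun c => Nat.ble c b ||
    (l11.all fun d => Nat.ble d c || good4 a b c d))
theorem all4_true : all4 = true := by decide +kernel

def vec4 (a : Fin 16) : Fin 4 → ZMod 2 := fun i => ((a.val / 2 ^ i.val % 2 : ℕ) : ZMod 2)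

lemma vec4_surj (w : Fin 4 → ZMod 2) : ∃ a, vec4 a = w := by
  revert w; decide +kernel

lemma vec4_dot : ∀ f a : Fin 16, (if vec4 f ⬝ᵥ vec4 a ≠ 0 then 1 else 0) = par4 (f.val &&& a.val) := by
  decide +kernel

lemma vec4_single : ∀ f : Fin 16, (∑ i : Fin 4, if vec4 f i ≠ 0 then 1 else 0) = pop4 f.val := by
  decide +kernel

lemma vec4_disj : ∀ f g : Fin 16, (f.val &&& g.val) = 0 → ∀ i, vec4 f i = 0 ∨ vec4 g i = 0 := by
  decide +kernel

lemma vec4_ne : ∀ f : Fin 16, f.val ≠ 0 → vec4 f ≠ 0 := by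
  decide +kernel

lemma vec4_l11 : ∀ a : Fin 16, vec4 a ≠ 0 → (∀ i, vec4 a ≠ Pi.single i 1) → a.val ∈ l11 := by
  decide +kernel

lemma l15_lt : ∀ f ∈ l15, f < 16 ∧ f ≠ 0 := by decide

/-- The finite configuration conditions. -/
def Cfg (r s : ℕ) (Q : Fin r ⊕ Fin s → Fin r → ZMod 2) : Prop :=
  (∀ i, Q (Sum.inl i) = Pi.single i 1) ∧ Function.Injective Q ∧ (∀ i, Q i ≠ 0) ∧
  (∀ f : Fin r → ZMod 2, f ≠ 0 → 2 < (Finset.univ.filter (fun i => f ⬝ᵥ Q i ≠ 0)).card) ∧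
  (r ≤ 4 → ∀ f g : Fin r → ZMod 2, f ≠ 0 → g ≠ 0 → (∀ i, f ⬝ᵥ Q i = 0 ∨ g ⬝ᵥ Q i = 0) →
    (Finset.univ.filter (fun i => f ⬝ᵥ Q i ≠ 0)).card ≤ 4 →
    (Finset.univ.filter (fun i => g ⬝ᵥ Q i ≠ 0)).card ≤ 4 → False)

lemma Cfg.perm {r s : ℕ} {Q : Fin r ⊕ Fin s → Fin r → ZMod 2} (h : Cfg r s Q)
    (σ : Equiv.Perm (Fin s)) : Cfg r s (Q ∘ Sum.map id σ) := by
  obtain ⟨h1, h2, h3, h4, h5⟩ := h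
  have hc : ∀ f : Fin r → ZMod 2,
      (Finset.univ.filter (fun i => f ⬝ᵥ (Q ∘ Sum.map id σ) i ≠ 0)).card =
      (Finset.univ.filter (fun i => f ⬝ᵥ Q i ≠ 0)).card := by
    intro f
    refine Finset.card_equiv (Equiv.sumCongr (Equiv.refl _) σ) ?_
    intro i
    rcases i with i | i <;> simp
  refine ⟨fun i => by simpa using h1 i, ?_, fun i => h3 _, ?_, ?_⟩
  · exact h2.comp (Function.Injective.sumMap Function.injective_id σ.injective)
  · intro f hf; rw [hc]; exact h4 f hf
  · intro hr4 f g hf hg hd hcf hcg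
    rw [hc] at hcf hcg
    refine h5 hr4 f g hf hg ?_ hcf hcg
    intro i
    have := hd ((Equiv.sumCongr (Equiv.refl _) σ).symm i)
    rcases i with i | i <;> simpa using this

lemma cfg4_false (Q : Fin 4 ⊕ Fin 4 → Fin 4 → ZMod 2) (h : Cfg 4 4 Q) : False := by
  choose a0 ha0 using fun j : Fin 4 => vec4_surj (Q (Sum.inr j))
  have h' := h.perm (Tuple.sort a0)
  have hmono := Tuple.monotone_sort a0
  set Q' := Q ∘ Sum.map id (Tuple.sort a0) with hQ'
  set a := a0 ∘ Tuple.sort a0 with ha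
  have hQa : ∀ j, Q' (Sum.inr j) = vec4 (a j) := by
    intro j; simp [hQ', ha, ha0]
  clear_value Q' a
  clear hQ' ha
  obtain ⟨h1, h2, h3, h4, h5⟩ := h'
  have hstrict : StrictMono a := by
    refine hmono.strictMono_of_injective ?_
    intro i j hij
    have : Q' (Sum.inr i) = Q' (Sum.inr j) := by rw [hQa, hQa, hij]
    exact Sum.inr_injective (h2 this)
  have hl : ∀ j, (a j).val ∈ l11 := by
    intro j
    refine vec4_l11 _ ?_ ?_
    · rw [← hQa]; exact h3 _
    · intro i hi
      rw [← hQa, ← h1] at hi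
      simpa using h2 hi
  have h01 : (a 0).val < (a 1).val := hstrict (by decide)
  have h12 : (a 1).val < (a 2).val := hstrict (by decide)
  have h23 : (a 2).val < (a 3).val := hstrict (by decide)
  have hwt : ∀ f : Fin 16, (Finset.univ.filter (fun i => vec4 f ⬝ᵥ Q' i ≠ 0)).card =
      wt4 (a 0).val (a 1).val (a 2).val (a 3).val f.val := by
    intro f
    rw [Finset.card_filter, Fintype.sum_sum_type]
    simp only [h1, hQa, vec4_dot, dotProduct_single, mul_one, vec4_single]
    simp only [Fin.sum_univ_four, wt4]
    ring
  have hall := all4_true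
  unfold all4 at hall
  have e1 := (List.all_eq_true.1 hall) _ (hl 0)
  have e2 := (List.all_eq_true.1 e1) _ (hl 1)
  rw [Bool.or_eq_true, Nat.ble_eq] at e2
  have e3 := (List.all_eq_true.1 (e2.resolve_left (by omega))) _ (hl 2)
  rw [Bool.or_eq_true, Nat.ble_eq] at e3
  have e4 := (List.all_eq_true.1 (e3.resolve_left (by omega))) _ (hl 3)
  rw [Bool.or_eq_true, Nat.ble_eq] at e4
  have e5 := e4.resolve_left (by omega)
  unfold good4 at e5
  obtain ⟨f, hf, e6⟩ := List.any_eq_true.1 e5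
  obtain ⟨hf16, hf0⟩ := l15_lt f hf
  have hwf := hwt ⟨f, hf16⟩
  have hfn := vec4_ne ⟨f, hf16⟩ hf0
  rw [Bool.or_eq_true, Nat.ble_eq] at e6
  rcases e6 with e6 | e6
  · have := h4 _ hfn
    rw [hwf] at this
    simp only at this
    omega
  · rw [Bool.and_eq_true, Nat.ble_eq] at e6
    obtain ⟨e6, e7⟩ := e6
    obtain ⟨g, hg, e8⟩ := List.any_eq_true.1 e7
    obtain ⟨hg16, hg0⟩ := l15_lt g hg
    have hwg := hwt ⟨g, hg16⟩
    have hgn := vec4_ne ⟨g, hg16⟩ hg0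
    rw [Bool.and_eq_true, Nat.ble_eq] at e8
    obtain ⟨e8, e9⟩ := e8
    refine h5 le_rfl _ _ hfn hgn ?_ (by rw [hwf]; exact e6) (by rw [hwg]; exact e9)
    simp only [dis4, Bool.and_eq_true, Nat.beq_eq, mul_eq_zero] at e8
    obtain ⟨d0, d1, d2, d3, d4⟩ := e8
    have key : ∀ b : Fin 16, (par4 (f &&& b.val) = 0 ∨ par4 (g &&& b.val) = 0) →
        vec4 ⟨f, hf16⟩ ⬝ᵥ vec4 b = 0 ∨ vec4 ⟨g, hg16⟩ ⬝ᵥ vec4 b = 0 := by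
      intro b hb
      have x1 := vec4_dot ⟨f, hf16⟩ b
      have x2 := vec4_dot ⟨g, hg16⟩ b
      simp only at x1 x2
      rw [← x1, ← x2] at hb
      by_contra hcon
      push Not at hcon
      simp [hcon.1, hcon.2] at hb
    intro i
    rcases i with i | i
    · simp only [h1, dotProduct_single, mul_one]
      exact vec4_disj _ _ d0 i
    · rw [hQa]
      apply key
      fin_cases i <;> assumption

lemma cfg3_false (Q : Fin 3 ⊕ Fin 5 → Fin 3 → ZMod 2) (h : Cfg 3 5 Q) : False := by
  obtain ⟨h1, h2, h3, h4, h5⟩ := h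
  have hb := (Fintype.bijective_iff_injective_and_card Q).2 ⟨h2, by simp [ZMod.card]⟩
  obtain ⟨i, hi⟩ := hb.2 0
  exact h3 i hi

lemma cfg5_false (Q : Fin 5 ⊕ Fin 3 → Fin 5 → ZMod 2) (h : Cfg 5 3 Q) : False := by
  obtain ⟨h1, h2, h3, h4, h5⟩ := h
  let R : Fin 5 → Fin 3 → ZMod 2 := fun i j => Q (Sum.inr j) i
  let T : Fin 5 ⊕ Fin 3 → Fin 3 → ZMod 2 := Sum.elim R (fun j => Pi.single j 1)
  have hR0 : ∀ i, R i ≠ 0 := by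
    intro i hi
    have hx := h4 (Pi.single i 1) (by simp)
    have : (Finset.univ.filter (fun k => (Pi.single i 1 : Fin 5 → ZMod 2) ⬝ᵥ Q k ≠ 0))
        ⊆ {Sum.inl i} := by
      intro k hk
      simp only [Finset.mem_filter, Finset.mem_univ, true_and, single_dotProduct, one_mul] at hk
      rcases k with k | k
      · rw [h1] at hk
        simp [Pi.single_apply] at hk
        simp [hk]
      · exact absurd (congrFun hi k) hk
    have := Finset.card_le_card this
    simp only [Finset.card_singleton] at this
    omega
  have hT0 : ∀ k, T k ≠ 0 := by
    rintro (k | k)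
    · exact hR0 k
    · simp [T]
  have hT : Function.Injective T := by
    have hmix : ∀ i j, R i ≠ Pi.single j 1 := by
      intro i j hij
      have hx := h4 (Pi.single i 1) (by simp)
      have : (Finset.univ.filter (fun k => (Pi.single i 1 : Fin 5 → ZMod 2) ⬝ᵥ Q k ≠ 0))
          ⊆ {Sum.inl i, Sum.inr j} := by
        intro k hk
        simp only [Finset.mem_filter, Finset.mem_univ, true_and, single_dotProduct, one_mul] at hk
        rcases k with k | k
        · rw [h1] at hk
          simp [Pi.single_apply] at hk
          simp [hk]
        · have := congrFun hij k
          simp only [R] at this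
          rw [this] at hk
          simp [Pi.single_apply] at hk
          simp [hk]
      have := (Finset.card_le_card this).trans Finset.card_le_two
      omega
    rintro (i | i) (j | j) hij
    · by_contra hne
      have hne' : i ≠ j := fun h => hne (by rw [h])
      have hij' : R i = R j := hij
      have hx := h4 (Pi.single i 1 + Pi.single j 1) (by
        intro h0
        have := congrFun h0 i
        simp [Pi.single_apply, hne'] at this)
      have : (Finset.univ.filter (fun k =>
          (Pi.single i 1 + Pi.single j 1 : Fin 5 → ZMod 2) ⬝ᵥ Q k ≠ 0))
          ⊆ {Sum.inl i, Sum.inl j} := by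
        intro k hk
        simp only [Finset.mem_filter, Finset.mem_univ, true_and, add_dotProduct,
          single_dotProduct, one_mul] at hk
        rcases k with k | k
        · rw [h1] at hk
          by_contra hk2
          simp at hk2
          have a1 : i ≠ k := fun h => hk2.1 h.symm
          have a2 : j ≠ k := fun h => hk2.2 h.symm
          simp [Pi.single_apply, a1, a2] at hk
        · have := congrFun hij' k
          simp only [R] at this
          rw [this] at hk
          exact absurd (CharTwo.add_self_eq_zero _) hk
      have := (Finset.card_le_card this).trans Finset.card_le_two
      omega
    · exact absurd hij (hmix i j)
    · exact absurd hij.symm (hmix j i)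
    · have : (Pi.single i 1 : Fin 3 → ZMod 2) = Pi.single j 1 := hij
      have := congrFun this i
      by_contra hne
      have hne' : i ≠ j := fun h => hne (by rw [h])
      simp [Pi.single_apply, hne'] at this
  have hb := (Fintype.bijective_iff_injective_and_card T).2 ⟨hT, by simp [ZMod.card]⟩
  obtain ⟨i, hi⟩ := hb.2 0
  exact hT0 i hi

lemma mRk_le_of {α : Type*} (M : Matroid α) (X : Set α) (k : ℕ)
    (h : ∀ I ⊆ X, M.Indep I → I.ncard ≤ k) : mRk M X ≤ k := by
  apply csSup_le'
  rintro _ ⟨I, ⟨h1, h2⟩, rfl⟩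
  exact h I h1 h2

lemma le_mRk {α : Type*} (M : Matroid α) (hfin : M.E.Finite) (I : Set α)
    (hI : M.Indep I) : I.ncard ≤ mRk M M.E := by
  refine le_csSup ⟨M.E.ncard, ?_⟩ ⟨I, ⟨hI.subset_ground, hI⟩, rfl⟩
  rintro _ ⟨J, ⟨h1, _⟩, rfl⟩
  exact Set.ncard_le_ncard h1 hfin

lemma mRk_le_ncard {α : Type*} (M : Matroid α) (X : Set α) (hX : X.Finite) :
    mRk M X ≤ X.ncard :=
  mRk_le_of M X _ fun _ hI _ => Set.ncard_le_ncard hI hX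

lemma base_max {α : Type*} (M : Matroid α) (hfin : M.E.Finite) {B : Set α} (hB : M.IsBase B)
    (I : Set α) (hI : M.Indep I) : I.ncard ≤ B.ncard := by
  obtain ⟨B', hB', hIB⟩ := hI.exists_isBase_superset
  rw [hB.ncard_eq_ncard_of_isBase hB']
  exact Set.ncard_le_ncard hIB (hfin.subset hB'.subset_ground)

lemma mRk_le_base {α : Type*} (M : Matroid α) (hfin : M.E.Finite) {B : Set α} (hB : M.IsBase B)
    (X : Set α) : mRk M X ≤ B.ncard :=
  mRk_le_of M X _ fun I _ hI => base_max M hfin hB I hI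

/-- a functional vanishing on `X` but not on the base lowers the rank -/
lemma mRk_hyper {α : Type*} {n : ℕ} (M : Matroid α) (hfin : M.E.Finite)
    (v : α → (Fin n → ZMod 2)) (hv : IsBinRepOn M M.E v) {B : Set α} (hB : M.IsBase B)
    (φ : (Fin n → ZMod 2) →ₗ[ZMod 2] ZMod 2) (X : Set α) (hX : ∀ x ∈ X, φ (v x) = 0)
    (b : α) (hb : b ∈ B) (hφ : φ (v b) ≠ 0) : mRk M X + 1 ≤ B.ncard := by
  have hpos : 0 < B.ncard := by
    rw [Set.ncard_pos (hfin.subset hB.subset_ground)]; exact ⟨b, hb⟩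
  suffices mRk M X ≤ B.ncard - 1 by omega
  refine mRk_le_of M X _ fun I hIX hI => ?_
  have hbI : b ∉ I := fun h => hφ (hX b (hIX h))
  have hIE := hI.subset_ground
  have hins : insert b I ⊆ M.E := Set.insert_subset (hB.subset_ground hb) hIE
  have hlin : LinearIndepOn (ZMod 2) v I := (hv.2 I hIE).1 hI
  have hind : M.Indep (insert b I) := by
    rw [hv.2 _ hins]
    change LinearIndepOn (ZMod 2) v (insert b I)
    rw [linearIndepOn_insert hbI]
    refine ⟨hlin, fun hspan => hφ ?_⟩
    have : Submodule.span (ZMod 2) (v '' I) ≤ LinearMap.ker φ := by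
      rw [Submodule.span_le]
      rintro _ ⟨x, hx, rfl⟩
      exact hX x (hIX hx)
    exact this hspan
  have := base_max M hfin hB _ hind
  rw [Set.ncard_insert_of_notMem hbI (hfin.subset hIE)] at this
  omega

/-- coordinates with respect to a base -/
lemma exists_coord {α : Type*} {n r : ℕ} (M : Matroid α)
    (v : α → (Fin n → ZMod 2)) (hv : IsBinRepOn M M.E v) {B : Set α} (hB : M.IsBase B)
    (β : Fin r ≃ B) :
    ∃ π : (Fin n → ZMod 2) →ₗ[ZMod 2] (Fin r → ZMod 2),
      (∀ i, π (v (β i)) = Pi.single i 1) ∧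
      ∀ e ∈ M.E, v e = ∑ i, π (v e) i • v (β i) := by
  have hlinB : LinearIndepOn (ZMod 2) v B := (hv.2 B hB.subset_ground).1 hB.indep
  have hlin : LinearIndependent (ZMod 2) (fun i => v (β i)) :=
    LinearIndependent.comp hlinB β β.injective
  let L := Fintype.linearCombination (ZMod 2) (fun i => v (β i))
  have hL : LinearMap.ker L = ⊥ := by
    rw [LinearMap.ker_eq_bot]
    exact linearIndependent_iff_injective_fintypeLinearCombination.1 hlin
  obtain ⟨π, hπ⟩ := LinearMap.exists_leftInverse_of_injective L hL
  have hLs : ∀ i, L (Pi.single i 1) = v (β i) := by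
    intro i
    simp [L]
  have h1 : ∀ i, π (v (β i)) = Pi.single i 1 := by
    intro i
    rw [← hLs]
    exact LinearMap.congr_fun hπ _
  refine ⟨π, h1, fun e he => ?_⟩
  have hmem : v e ∈ Submodule.span (ZMod 2) (v '' B) := by
    by_contra hcon
    have heB : e ∉ B := fun h => hcon (Submodule.subset_span ⟨e, h, rfl⟩)
    have hind : M.Indep (insert e B) := by
      rw [hv.2 _ (Set.insert_subset he hB.subset_ground)]
      change LinearIndepOn (ZMod 2) v (insert e B)
      rw [linearIndepOn_insert heB]
      exact ⟨hlinB, hcon⟩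
    have := hB.eq_of_subset_indep hind (Set.subset_insert _ _)
    exact heB (this ▸ Set.mem_insert _ _)
  have hle : Submodule.span (ZMod 2) (v '' B) ≤ LinearMap.eqLocus (L ∘ₗ π) LinearMap.id := by
    rw [Submodule.span_le]
    rintro _ ⟨b, hb, rfl⟩
    have hbb : v b = v (β (β.symm ⟨b, hb⟩)) := by simp
    rw [hbb]
    simp only [SetLike.mem_coe, LinearMap.mem_eqLocus, LinearMap.comp_apply, h1, hLs,
      LinearMap.id_apply]
  have := hle hmem
  rw [LinearMap.mem_eqLocus] at this
  exact this.symm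

lemma sep_compl {α : Type*} (M : Matroid α) (h8 : M.E.ncard = 8) (X : Set α) (hX : X ⊆ M.E) :
    Disjoint X (M.E \ X) ∧ X ∪ (M.E \ X) = M.E ∧ X.ncard + (M.E \ X).ncard = 8 := by
  have hfin : M.E.Finite := Set.finite_of_ncard_ne_zero (by omega)
  refine ⟨Set.disjoint_sdiff_right, Set.union_sdiff_cancel hX, ?_⟩
  rw [← h8, add_comm]
  exact Set.ncard_sdiff_add_ncard_of_subset hX hfin

/-- the rank of any two-element side is at least two -/
lemma pair_indep {α : Type*} (M : Matroid α) (h8 : M.E.ncard = 8) (h : mInternally4 M)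
    (e e' : α) (he : e ∈ M.E) (he' : e' ∈ M.E) (hne : e ≠ e') : M.Indep {e, e'} := by
  by_contra hdep
  have hfin : M.E.Finite := Set.finite_of_ncard_ne_zero (by omega)
  obtain ⟨B, hB⟩ := M.exists_isBase
  have hX : ({e, e'} : Set α) ⊆ M.E := by
    rintro x (rfl | rfl) <;> assumption
  obtain ⟨s1, s2, s3⟩ := sep_compl M h8 _ hX
  have hc : ({e, e'} : Set α).ncard = 2 := Set.ncard_pair hne
  refine h.1.2 {e, e'} (M.E \ {e, e'}) ⟨s1, s2, by omega, by omega, ?_⟩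
  have a1 := mRk_le_base M hfin hB (M.E \ {e, e'})
  have a2 := le_mRk M hfin B hB.indep
  have a3 : mRk M {e, e'} ≤ 1 := by
    refine mRk_le_of _ _ _ fun I hI hind => ?_
    by_contra hlt
    have : I = {e, e'} := Set.eq_of_subset_of_ncard_le hI (by omega) (Set.toFinite _)
    exact hdep (this ▸ hind)
  omega

/-- There is no internally 4-connected binary matroid on exactly 8 elements. -/
theorem statement14 {α : Type*} (M : Matroid α) (hb : mBinary M) (h8 : M.E.ncard = 8) :
    ¬ mInternally4 M := by
  intro h
  obtain ⟨n, v, hv⟩ := hb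
  have hfin : M.E.Finite := Set.finite_of_ncard_ne_zero (by omega)
  obtain ⟨B, hB⟩ := M.exists_isBase
  have hBfin := hfin.subset hB.subset_ground
  have hbig := le_mRk M hfin B hB.indep
  -- no 4-4 separations
  have h44 : ∀ X ⊆ M.E, X.ncard = 4 → mRk M X + mRk M (M.E \ X) ≤ B.ncard + 2 → False := by
    intro X hX hc hr
    obtain ⟨s1, s2, s3⟩ := sep_compl M h8 X hX
    have := h.2 X (M.E \ X) ⟨s1, s2, by omega, by omega, by omega⟩
    omega
  obtain ⟨X0, hX0, hX0c⟩ : ∃ X ⊆ M.E, X.ncard = 4 := by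
    obtain ⟨X, hX, hXc⟩ := Set.exists_subset_card_eq (s := M.E) (n := 4) (by omega)
    exact ⟨X, hX, hXc⟩
  obtain ⟨s1, s2, s3⟩ := sep_compl M h8 X0 hX0
  have hr3 : 3 ≤ B.ncard := by
    by_contra hlt
    have a1 := mRk_le_base M hfin hB X0
    have a2 := mRk_le_base M hfin hB (M.E \ X0)
    exact h44 X0 hX0 hX0c (by omega)
  have hr5 : B.ncard ≤ 5 := by
    by_contra hlt
    have a1 := mRk_le_ncard M X0 (hfin.subset hX0)
    have a2 := mRk_le_ncard M (M.E \ X0) (hfin.subset Set.sdiff_subset)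
    exact h44 X0 hX0 hX0c (by omega)
  -- enumerate
  have hcB : (M.E \ B).ncard = 8 - B.ncard := by
    obtain ⟨_, _, t⟩ := sep_compl M h8 B hB.subset_ground
    omega
  have key : ∀ r s : ℕ, B.ncard = r → (M.E \ B).ncard = s →
      ∃ Q : Fin r ⊕ Fin s → Fin r → ZMod 2, Cfg r s Q := by
    intro r s hr hs
    have := hBfin.fintype
    have := (hfin.subset (Set.sdiff_subset (s := M.E) (t := B))).fintype
    let β : Fin r ≃ B := (Fintype.equivFinOfCardEq (by
      rw [← hr, Set.ncard_eq_toFinset_card', Set.toFinset_card])).symm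
    let γ : Fin s ≃ (M.E \ B : Set α) := (Fintype.equivFinOfCardEq (by
      rw [← hs, Set.ncard_eq_toFinset_card', Set.toFinset_card])).symm
    let δ : Fin r ⊕ Fin s → α := Sum.elim (fun i => (β i : α)) (fun j => (γ j : α))
    have hδE : ∀ i, δ i ∈ M.E := by
      rintro (i | i)
      · exact hB.subset_ground (β i).2
      · exact (γ i).2.1
    have hδinj : Function.Injective δ := by
      rintro (i | i) (j | j) hij
      · exact congrArg _ (β.injective (Subtype.ext hij))
      · exact absurd ((show (β i : α) = γ j from hij) ▸ (β i).2) (γ j).2.2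
      · exact absurd ((show (γ i : α) = β j from hij) ▸ (β j).2) (γ i).2.2
      · exact congrArg _ (γ.injective (Subtype.ext hij))
    have hδsurj : ∀ e ∈ M.E, ∃ i, δ i = e := by
      intro e he
      by_cases heB : e ∈ B
      · exact ⟨Sum.inl (β.symm ⟨e, heB⟩), by simp [δ]⟩
      · exact ⟨Sum.inr (γ.symm ⟨e, he, heB⟩), by simp [δ]⟩
    obtain ⟨π, hπ1, hπ2⟩ := exists_coord M v hv hB β
    have hpair : ∀ e e', e ∈ M.E → e' ∈ M.E → e ≠ e' → LinearIndepOn (ZMod 2) v {e, e'} := by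
      intro e e' he he' hne
      have hX : ({e, e'} : Set α) ⊆ M.E := by
        rintro x (rfl | rfl) <;> assumption
      exact (hv.2 _ hX).1 (pair_indep M h8 h e e' he he' hne)
    -- functionals
    have hfun : ∀ f : Fin r → ZMod 2, f ≠ 0 → ∀ X : Set α, (∀ x ∈ X, f ⬝ᵥ π (v x) = 0) →
        mRk M X + 1 ≤ B.ncard := by
      intro f hf X hX
      obtain ⟨i, hi⟩ : ∃ i, f i ≠ 0 := by
        by_contra hcon
        push Not at hcon
        exact hf (funext hcon)
      let φ : (Fin n → ZMod 2) →ₗ[ZMod 2] ZMod 2 :=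
        { toFun := fun w => f ⬝ᵥ π w
          map_add' := by intro x y; simp [dotProduct_add]
          map_smul' := by intro c x; simp [dotProduct_smul] }
      refine mRk_hyper M hfin v hv hB φ X hX (β i) (β i).2 ?_
      change f ⬝ᵥ π (v (β i)) ≠ 0
      rw [hπ1]
      simpa using hi
    have hcard : ∀ f : Fin r → ZMod 2, {e ∈ M.E | f ⬝ᵥ π (v e) ≠ 0}.ncard =
        (Finset.univ.filter (fun i => f ⬝ᵥ π (v (δ i)) ≠ 0)).card := by
      intro f
      have : {e ∈ M.E | f ⬝ᵥ π (v e) ≠ 0} =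
          δ '' (Finset.univ.filter (fun i => f ⬝ᵥ π (v (δ i)) ≠ 0) : Finset _) := by
        ext e
        constructor
        · rintro ⟨he, hne⟩
          obtain ⟨i, rfl⟩ := hδsurj e he
          exact ⟨i, by simpa using hne, rfl⟩
        · rintro ⟨i, hi, rfl⟩
          exact ⟨hδE i, by simpa using hi⟩
      rw [this, Set.ncard_image_of_injective _ hδinj, Set.ncard_coe_finset]
    refine ⟨fun i => π (v (δ i)), hπ1, ?_, ?_, ?_, ?_⟩
    · intro i j hij
      by_contra hne
      have hvv : v (δ i) = v (δ j) := by
        rw [hπ2 _ (hδE i), hπ2 _ (hδE j)]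
        simp only at hij
        rw [hij]
      have hne' : δ i ≠ δ j := fun h => hne (hδinj h)
      have hl := hpair _ _ (hδE i) (hδE j) hne'
      exact hne' (hl.injOn (by simp) (by simp) hvv)
    · intro i h0
      have hv0 : v (δ i) = 0 := by
        rw [hπ2 _ (hδE i)]
        simp only at h0
        simp [h0]
      obtain ⟨e, he, hne⟩ := Set.exists_ne_of_one_lt_ncard (s := M.E) (by omega) (δ i)
      have hl := hpair _ _ (hδE i) he hne.symm
      exact hl.ne_zero (by simp : δ i ∈ ({δ i, e} : Set α)) hv0
    · intro f hf
      by_contra hlt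
      rw [← hcard] at hlt
      obtain ⟨Y, hY1, hY2, hY3⟩ := Set.exists_subsuperset_card_eq (n := 2)
        (Set.sep_subset M.E (fun e => f ⬝ᵥ π (v e) ≠ 0)) (by omega) (by omega)
      obtain ⟨t1, t2, t3⟩ := sep_compl M h8 Y hY2
      refine h.1.2 Y (M.E \ Y) ⟨t1, t2, by omega, by omega, ?_⟩
      have a1 := mRk_le_ncard M Y (hfin.subset hY2)
      have a2 := hfun f hf (M.E \ Y) (by
        rintro x ⟨hx, hxY⟩
        by_contra hx0
        exact hxY (hY1 ⟨hx, hx0⟩))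
      omega
    · intro hr4 f g hf hg hd hcf hcg
      rw [← hcard] at hcf hcg
      -- `Y` contains the support of `f` and avoids that of `g`
      have hsub : {e ∈ M.E | f ⬝ᵥ π (v e) ≠ 0} ⊆ M.E \ {e ∈ M.E | g ⬝ᵥ π (v e) ≠ 0} := by
        rintro e ⟨he, hfe⟩
        refine ⟨he, fun hge => ?_⟩
        obtain ⟨i, rfl⟩ := hδsurj e he
        rcases hd i with h0 | h0
        · exact hfe h0
        · exact hge.2 h0
      obtain ⟨_, _, t3⟩ := sep_compl M h8 _ (Set.sep_subset M.E (fun e => g ⬝ᵥ π (v e) ≠ 0))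
      obtain ⟨Y, hY1, hY2, hY3⟩ := Set.exists_subsuperset_card_eq (n := 4) hsub hcf (by
        change 4 ≤ (M.E \ {e ∈ M.E | g ⬝ᵥ π (v e) ≠ 0}).ncard
        change Set.ncard {e ∈ M.E | g ⬝ᵥ π (v e) ≠ 0} + _ = 8 at t3
        omega)
      refine h44 Y (hY2.trans Set.sdiff_subset) hY3 ?_
      have a1 := hfun g hg Y (by
        intro x hx
        by_contra hx0
        exact (hY2 hx).2 ⟨(hY2 hx).1, hx0⟩)
      have a2 := hfun f hf (M.E \ Y) (by
        rintro x ⟨hx, hxY⟩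
        by_contra hx0
        exact hxY (hY1 ⟨hx, hx0⟩))
      omega
  have hcases : B.ncard = 3 ∨ B.ncard = 4 ∨ B.ncard = 5 := by omega
  rcases hcases with hr | hr | hr
  · obtain ⟨Q, hQ⟩ := key 3 5 hr (by omega)
    exact cfg3_false Q hQ
  · obtain ⟨Q, hQ⟩ := key 4 4 hr (by omega)
    exact cfg4_false Q hQ
  · obtain ⟨Q, hQ⟩ := key 5 3 hr (by omega)
    exact cfg5_false Q hQ
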